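/- Let p ≥ 1, let S be a p×p real symmetric positive semidefinite matrix, let ρ > 0, and set α = 1/(‖S‖₂ + pρ). Let Θ* be a p×p real symmetric positive definite matrix with αI ⪯ Θ* which is a fixed point of the G-ISTA step for every step size in (0, α²]. Let Θ₀ be symmetric positive definite with αI ⪯ Θ₀, let ζ_t ∈ (0, α²] for all t, and define Θ_{t+1} = η_{ζ_t ρ}(Θ_t − ζ_t(S − Θ_t⁻¹)). Then ‖Θ_t − Θ*‖_F ≤ ‖Θ₀ − Θ*‖_F for all t, and consequently λ_max(Θ_t) ≤ ‖Θ*‖₂ + ‖Θ₀ − Θ*‖_F for all t. -/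

import Mathlib

open Matrix

/-- Entrywise soft-thresholding operator `η_c`. -/
noncomputable def softThresh {n : Type*} [Fintype n] (c : ℝ) (X : Matrix n n ℝ) :
    Matrix n n ℝ :=
  fun i j => Real.sign (X i j) * max (|X i j| - c) 0

/-- Frobenius norm of a real matrix. -/
noncomputable def frobNorm {n : Type*} [Fintype n] (A : Matrix n n ℝ) : ℝ :=
  Real.sqrt (∑ i, ∑ j, (A i j) ^ 2)

/-- Smallest eigenvalue of a real symmetric matrix (as the infimum of the
Rayleigh quotient over the unit sphere). -/
noncomputable def lmin {n : Type*} [Fintype n] (A : Matrix n n ℝ) : ℝ :=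
  ⨅ x : {x : n → ℝ // ∑ i, (x i) ^ 2 = 1}, x.1 ⬝ᵥ A.mulVec x.1

/-- Largest eigenvalue of a real symmetric matrix. -/
noncomputable def lmax {n : Type*} [Fintype n] (A : Matrix n n ℝ) : ℝ :=
  ⨆ x : {x : n → ℝ // ∑ i, (x i) ^ 2 = 1}, x.1 ⬝ᵥ A.mulVec x.1

/-- Spectral norm (largest singular value) of a real matrix. -/
noncomputable def specNorm {n : Type*} [Fintype n] (A : Matrix n n ℝ) : ℝ :=
  ⨆ x : {x : n → ℝ // ∑ i, (x i) ^ 2 = 1}, Real.sqrt (∑ i, (A.mulVec x.1 i) ^ 2)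

/-- Scalar soft-thresholding moves its argument by at most the threshold. -/
lemma abs_sign_mul_max_sub_le {c : ℝ} (hc : 0 ≤ c) (a : ℝ) :
    |Real.sign a * max (|a| - c) 0 - a| ≤ c := by
  rcases lt_trichotomy a 0 with h | h | h
  · rw [Real.sign_of_neg h, abs_of_neg h, abs_le]
    rcases max_cases (-a - c) 0 with ⟨h1, h2⟩ | ⟨h1, h2⟩ <;> rw [h1] <;>
      constructor <;> linarith
  · simp [h, hc]
  · rw [Real.sign_of_pos h, abs_of_pos h, abs_le]
    rcases max_cases (a - c) 0 with ⟨h1, h2⟩ | ⟨h1, h2⟩ <;> rw [h1] <;>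
      constructor <;> linarith

/-- Scalar soft-thresholding is the positive part of `a - c` minus that of `-a - c`. -/
lemma sign_mul_max_eq {c : ℝ} (hc : 0 ≤ c) (a : ℝ) :
    Real.sign a * max (|a| - c) 0 = max (a - c) 0 - max (-a - c) 0 := by
  rcases lt_trichotomy a 0 with h | h | h
  · rw [Real.sign_of_neg h, abs_of_neg h, max_eq_right (by linarith : a - c ≤ 0)]
    ring
  · simp [h, hc]
  · rw [Real.sign_of_pos h, abs_of_pos h, max_eq_right (by linarith : -a - c ≤ 0)]
    ring

/-- Scalar soft-thresholding is nonexpansive. -/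
lemma abs_sign_mul_max_sub_sign_mul_max_le {c : ℝ} (hc : 0 ≤ c) (a b : ℝ) :
    |Real.sign a * max (|a| - c) 0 - Real.sign b * max (|b| - c) 0| ≤ |a - b| := by
  rw [sign_mul_max_eq hc, sign_mul_max_eq hc]
  rcases max_cases (a - c) 0 with ⟨h1, h1'⟩ | ⟨h1, h1'⟩ <;>
  rcases max_cases (b - c) 0 with ⟨h2, h2'⟩ | ⟨h2, h2'⟩ <;>
  rcases max_cases (-a - c) 0 with ⟨h3, h3'⟩ | ⟨h3, h3'⟩ <;>
  rcases max_cases (-b - c) 0 with ⟨h4, h4'⟩ | ⟨h4, h4'⟩ <;>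
  rw [h1, h2, h3, h4, abs_le] <;>
  rcases abs_cases (a - b) with ⟨h5, h5'⟩ | ⟨h5, h5'⟩ <;>
  rw [h5] <;> constructor <;> linarith

lemma posDef_of_sub_smul_one {n : Type*} [DecidableEq n] {α : ℝ} (hα : 0 < α)
    {A : Matrix n n ℝ} (hA : (A - α • 1).PosSemidef) : A.PosDef := by
  simpa using PosDef.posSemidef_add hA (PosDef.one.smul hα)

section
variable {n : Type*} [Fintype n]

lemma frobNorm_softThresh_sub_le {c : ℝ} (hc : 0 ≤ c) (X Y : Matrix n n ℝ) :
    frobNorm (softThresh c X - softThresh c Y) ≤ frobNorm (X - Y) :=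
  Real.sqrt_le_sqrt <| Finset.sum_le_sum fun i _ => Finset.sum_le_sum fun j _ =>
    sq_le_sq.mpr (abs_sign_mul_max_sub_sign_mul_max_le hc (X i j) (Y i j))

lemma softThresh_isHermitian (c : ℝ) {X : Matrix n n ℝ} (hX : X.IsHermitian) :
    (softThresh c X).IsHermitian := by
  ext i j
  have h : X j i = X i j := by simpa using hX.apply i j
  simp [softThresh, h]

lemma dotProduct_mulVec_le_of_abs_le {c : ℝ} {A : Matrix n n ℝ}
    (hA : ∀ i j, |A i j| ≤ c) (hc : 0 ≤ c) (x : n → ℝ) :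
    x ⬝ᵥ A *ᵥ x ≤ Fintype.card n * c * (x ⬝ᵥ x) := by
  have h1 : x ⬝ᵥ A *ᵥ x ≤ c * (∑ i, |x i|) ^ 2 := by
    simp only [dotProduct, mulVec, Finset.mul_sum, sq, Finset.sum_mul]
    rw [Finset.sum_comm]
    refine Finset.sum_le_sum fun i _ => Finset.sum_le_sum fun j _ => ?_
    refine (le_abs_self _).trans ?_
    rw [abs_mul, abs_mul]
    nlinarith [mul_le_mul_of_nonneg_right (hA j i)
      (mul_nonneg (abs_nonneg (x i)) (abs_nonneg (x j)))]
  have h2 : (∑ i, |x i|) ^ 2 ≤ Fintype.card n * (x ⬝ᵥ x) := by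
    simpa [dotProduct, sq_abs, ← sq] using
      sq_sum_le_card_mul_sum_sq (s := Finset.univ) (f := fun i => |x i|)
  nlinarith [mul_le_mul_of_nonneg_left h2 hc]

lemma sqrt_sum_mulVec_sq_le (A : Matrix n n ℝ) (x : n → ℝ) :
    √(∑ i, (A *ᵥ x) i ^ 2) ≤ frobNorm A * √(∑ i, x i ^ 2) := by
  rw [frobNorm, ← Real.sqrt_mul (by positivity), Finset.sum_mul]
  exact Real.sqrt_le_sqrt <| Finset.sum_le_sum fun i _ =>
    Finset.sum_mul_sq_le_sq_mul_sq Finset.univ (A i) x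

lemma dotProduct_mulVec_le_of_sqrt_le {A : Matrix n n ℝ} {C : ℝ} {x : n → ℝ}
    (hx : ∑ i, x i ^ 2 = 1) (h : √(∑ i, (A *ᵥ x) i ^ 2) ≤ C) : x ⬝ᵥ A *ᵥ x ≤ C := by
  have := Real.sum_mul_le_sqrt_mul_sqrt Finset.univ x (A *ᵥ x)
  rw [hx, Real.sqrt_one, one_mul] at this
  exact this.trans h

lemma dotProduct_mulVec_le_frobNorm (A : Matrix n n ℝ) {x : n → ℝ}
    (hx : ∑ i, x i ^ 2 = 1) : x ⬝ᵥ A *ᵥ x ≤ frobNorm A :=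
  dotProduct_mulVec_le_of_sqrt_le hx (by simpa [hx] using sqrt_sum_mulVec_sq_le A x)

lemma dotProduct_mulVec_le_specNorm (A : Matrix n n ℝ) {x : n → ℝ}
    (hx : ∑ i, x i ^ 2 = 1) : x ⬝ᵥ A *ᵥ x ≤ specNorm A := by
  refine dotProduct_mulVec_le_of_sqrt_le hx ?_
  refine le_ciSup (f := fun y : {y : n → ℝ // ∑ i, (y i) ^ 2 = 1} =>
    √(∑ i, (A *ᵥ y.1) i ^ 2)) ⟨frobNorm A, ?_⟩ ⟨x, hx⟩
  rintro _ ⟨y, rfl⟩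
  simpa [y.2] using sqrt_sum_mulVec_sq_le A y.1

lemma specNorm_nonneg (A : Matrix n n ℝ) : 0 ≤ specNorm A :=
  Real.iSup_nonneg fun _ => Real.sqrt_nonneg _

lemma dotProduct_mulVec_le_specNorm_mul (A : Matrix n n ℝ) (x : n → ℝ) :
    x ⬝ᵥ A *ᵥ x ≤ specNorm A * (x ⬝ᵥ x) := by
  have hxx : x ⬝ᵥ x = ∑ i, x i ^ 2 := by simp [dotProduct, sq]
  have h0 : 0 ≤ x ⬝ᵥ x := by rw [hxx]; positivity
  rcases h0.eq_or_lt with h | h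
  · have : x = 0 := dotProduct_self_eq_zero.mp h.symm
    simp [this]
  · have hr : √(x ⬝ᵥ x) * √(x ⬝ᵥ x) = x ⬝ᵥ x := Real.mul_self_sqrt h0
    set r := √(x ⬝ᵥ x)
    have hr0 : 0 < r := Real.sqrt_pos.mpr h
    have hy : ∑ i, (r⁻¹ • x) i ^ 2 = 1 := by
      simp only [Pi.smul_apply, smul_eq_mul, mul_pow]
      rw [← Finset.mul_sum, ← hxx, ← hr]
      field_simp
    have := dotProduct_mulVec_le_specNorm A hy
    rw [mulVec_smul, dotProduct_smul, smul_dotProduct, smul_eq_mul, smul_eq_mul] at this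
    rw [← hr]
    calc x ⬝ᵥ A *ᵥ x = r⁻¹ * (r⁻¹ * (x ⬝ᵥ A *ᵥ x)) * (r * r) := by field_simp
      _ ≤ _ := mul_le_mul_of_nonneg_right this (by positivity)

lemma lmax_le_specNorm_add_frobNorm (A B : Matrix n n ℝ) :
    lmax A ≤ specNorm B + frobNorm (A - B) := by
  refine Real.iSup_le (fun x => ?_) (add_nonneg (specNorm_nonneg B) (Real.sqrt_nonneg _))
  have h : x.1 ⬝ᵥ A *ᵥ x.1 = x.1 ⬝ᵥ B *ᵥ x.1 + x.1 ⬝ᵥ (A - B) *ᵥ x.1 := by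
    rw [← dotProduct_add, ← add_mulVec, add_sub_cancel]
  rw [h]
  exact add_le_add (dotProduct_mulVec_le_specNorm B x.2) (dotProduct_mulVec_le_frobNorm _ x.2)

variable [DecidableEq n]

lemma posSemidef_trace_mul_nonneg {A B : Matrix n n ℝ} (hA : A.PosSemidef)
    (hB : B.PosSemidef) : 0 ≤ (A * B).trace := by
  open scoped MatrixOrder in
  obtain ⟨C, rfl⟩ := CStarAlgebra.nonneg_iff_eq_star_mul_self.mp hA.nonneg
  rw [Matrix.mul_assoc, trace_mul_comm]
  exact (hB.mul_mul_conjTranspose_same C).trace_nonneg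

/-- If `αI ⪯ A` and `ζ ≤ α²`, then `(α + ζ/α) I ⪯ A + ζ A⁻¹`. -/
lemma posSemidef_add_smul_inv_sub {α ζ : ℝ} (hα : 0 < α) (hζ : ζ ≤ α ^ 2)
    {A : Matrix n n ℝ} (hA : (A - α • 1).PosSemidef) :
    (A + ζ • A⁻¹ - (α + ζ / α) • 1).PosSemidef := by
  have hA' := posDef_of_sub_smul_one hα hA
  have hdet : IsUnit A.det := (isUnit_iff_isUnit_det A).mp hA'.isUnit
  have h1 : A * A⁻¹ = 1 := mul_nonsing_inv A hdet
  have h2 : A⁻¹ * A = 1 := nonsing_inv_mul A hdet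
  have hP : ((A - α • 1) * A⁻¹ * (A - α • 1)).PosSemidef := by
    have h := hA'.inv.posSemidef.mul_mul_conjTranspose_same (A - α • 1)
    rwa [hA.isHermitian.eq] at h
  have hQ : (1 - α • A⁻¹).PosSemidef := by
    have h3 := ((hA.pow 2).add (hA.smul hα.le)).mul_mul_conjTranspose_same A⁻¹
    rw [hA'.inv.isHermitian.eq] at h3
    convert h3 using 1
    have : (A - α • 1) ^ 2 + α • (A - α • 1) = A * A - α • A := by
      simp only [sq, sub_mul, mul_sub, smul_sub, smul_mul_assoc, mul_smul_comm, one_mul, mul_one]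
      abel
    rw [this, mul_sub, sub_mul, ← Matrix.mul_assoc, h2, Matrix.one_mul, h1]
    simp [h2]
  have hc : 0 ≤ α - ζ / α := by
    rw [sub_nonneg, div_le_iff₀ hα, ← sq]
    exact hζ
  convert hP.add (hQ.smul hc) using 1
  simp only [sub_mul, mul_sub, smul_sub, smul_mul_assoc, mul_smul_comm, one_mul, mul_one, h1, h2,
    smul_smul, sub_smul, add_smul, div_mul_cancel₀ _ hα.ne']
  abel

/-- A G-ISTA step preserves the lower bound `αI`. -/
lemma posSemidef_softThresh_step_sub {S : Matrix n n ℝ} (hS : S.PosSemidef) {ρ α ζ : ℝ}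
    (hρ : 0 ≤ ρ) (hα : 0 < α) (hα' : α⁻¹ = specNorm S + Fintype.card n * ρ)
    (hζ0 : 0 ≤ ζ) (hζ : ζ ≤ α ^ 2) {A : Matrix n n ℝ} (hA : (A - α • 1).PosSemidef) :
    (softThresh (ζ * ρ) (A - ζ • (S - A⁻¹)) - α • 1).PosSemidef := by
  have hA' := posDef_of_sub_smul_one hα hA
  have hc : 0 ≤ ζ * ρ := mul_nonneg hζ0 hρ
  set X := A - ζ • (S - A⁻¹) with hX
  have hXH : X.IsHermitian :=
    hA'.isHermitian.sub ((hS.isHermitian.sub hA'.inv.isHermitian).smul (.all ζ))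
  have hone : (α • 1 : Matrix n n ℝ).IsHermitian := isHermitian_one.smul (.all α)
  refine .of_dotProduct_mulVec_nonneg ((softThresh_isHermitian _ hXH).sub hone) fun x => ?_
  have h1 := (posSemidef_add_smul_inv_sub hα hζ hA).dotProduct_mulVec_nonneg x
  have h2 := mul_le_mul_of_nonneg_left (dotProduct_mulVec_le_specNorm_mul S x) hζ0
  have h3 := dotProduct_mulVec_le_of_abs_le (A := X - softThresh (ζ * ρ) X) (c := ζ * ρ)
    (fun i j => by
      rw [Matrix.sub_apply, abs_sub_comm]
      exact abs_sign_mul_max_sub_le hc (X i j)) hc x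
  rw [div_eq_mul_inv, hα'] at h1
  simp only [hX, star_trivial, sub_mulVec, add_mulVec, smul_mulVec, one_mulVec, dotProduct_sub,
    dotProduct_add, dotProduct_smul, smul_eq_mul] at h1 h3 ⊢
  linarith

/-- The gradient step of the log-determinant part is nonexpansive on `{A | αI ⪯ A}`. -/
lemma frobNorm_sub_add_smul_inv_sub_inv_le {α ζ : ℝ} (hα : 0 < α) (hζ0 : 0 ≤ ζ)
    (hζ : ζ ≤ α ^ 2) {A B : Matrix n n ℝ} (hA : (A - α • 1).PosSemidef)
    (hB : (B - α • 1).PosSemidef) :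
    frobNorm (A - B + ζ • (A⁻¹ - B⁻¹)) ≤ frobNorm (A - B) := by
  have hA' := posDef_of_sub_smul_one hα hA
  have hB' := posDef_of_sub_smul_one hα hB
  have hAdet : IsUnit A.det := (isUnit_iff_isUnit_det A).mp hA'.isUnit
  have hBdet : IsUnit B.det := (isUnit_iff_isUnit_det B).mp hB'.isUnit
  set E := A⁻¹ - B⁻¹ with hE
  have hD : A - B = -(A * E * B) := by
    rw [hE, mul_sub, mul_nonsing_inv A hAdet, sub_mul, Matrix.one_mul, Matrix.mul_assoc,
      nonsing_inv_mul B hBdet, Matrix.mul_one, neg_sub]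
  have hfrob (M : Matrix n n ℝ) : ∑ i, ∑ j, M i j ^ 2 = (Mᵀ * M).trace := by
    rw [Finset.sum_comm]
    simp [trace, mul_apply, sq]
  have hEE : 0 ≤ (Eᵀ * E).trace := by rw [← hfrob]; positivity
  have hEB : α * (Eᵀ * E).trace ≤ (E * B * Eᵀ).trace := by
    have := (hB.mul_mul_conjTranspose_same E).trace_nonneg
    rw [conjTranspose_eq_transpose_of_trivial] at this
    simp only [mul_sub, sub_mul, mul_smul_comm, smul_mul_assoc, mul_one, trace_sub, trace_smul,
      smul_eq_mul] at this
    rw [trace_mul_comm E Eᵀ] at this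
    linarith
  have hAEB : α * (E * B * Eᵀ).trace ≤ (A * E * B * Eᵀ).trace := by
    have h := hB'.posSemidef.mul_mul_conjTranspose_same E
    rw [conjTranspose_eq_transpose_of_trivial] at h
    have := posSemidef_trace_mul_nonneg hA h
    simp only [sub_mul, smul_mul_assoc, one_mul, trace_sub, trace_smul, smul_eq_mul,
      ← Matrix.mul_assoc] at this
    linarith
  refine Real.sqrt_le_sqrt ?_
  rw [hfrob, hfrob]
  have hcross : (Eᵀ * (A - B)).trace = -(A * E * B * Eᵀ).trace := by
    rw [trace_mul_comm, hD, neg_mul, trace_neg]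
  have hcross' : ((A - B)ᵀ * E).trace = -(A * E * B * Eᵀ).trace := by
    rw [← hcross, ← trace_transpose, transpose_mul, transpose_transpose]
  have hexp : ((A - B + ζ • E)ᵀ * (A - B + ζ • E)).trace =
      ((A - B)ᵀ * (A - B)).trace - 2 * ζ * (A * E * B * Eᵀ).trace + ζ ^ 2 * (Eᵀ * E).trace := by
    rw [transpose_add, transpose_smul, add_mul, mul_add, mul_add]
    simp only [smul_mul_assoc, mul_smul_comm, trace_add, trace_smul, smul_eq_mul, hcross, hcross']
    ring
  rw [hexp]
  have h1 : ζ * (Eᵀ * E).trace ≤ α ^ 2 * (Eᵀ * E).trace := mul_le_mul_of_nonneg_right hζ hEE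
  have h2 : α ^ 2 * (Eᵀ * E).trace ≤ (A * E * B * Eᵀ).trace := by
    nlinarith [mul_le_mul_of_nonneg_left hEB hα.le]
  have h3 : 0 ≤ (A * E * B * Eᵀ).trace := (mul_nonneg (sq_nonneg α) hEE).trans h2
  nlinarith [mul_le_mul_of_nonneg_left (h1.trans h2) hζ0, mul_nonneg hζ0 h3]

end

/-- The G-ISTA iterates stay within the initial Frobenius distance of the
fixed point, and hence their largest eigenvalues are bounded above by
`‖Θ*‖₂ + ‖Θ₀ − Θ*‖_F`. -/
theorem gista_iterates_upper_bound {p : ℕ} (hp : 0 < p)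
    (S : Matrix (Fin p) (Fin p) ℝ) (hS : S.PosSemidef)
    (ρ : ℝ) (hρ : 0 < ρ)
    (α : ℝ) (hα : α = 1 / (specNorm S + p * ρ))
    (Θs : Matrix (Fin p) (Fin p) ℝ) (hΘs : Θs.PosDef)
    (hΘslb : (Θs - α • 1).PosSemidef)
    (hfix : ∀ ζ' : ℝ, 0 < ζ' → ζ' ≤ α ^ 2 →
      Θs = softThresh (ζ' * ρ) (Θs - ζ' • (S - Θs⁻¹)))
    (Θ : ℕ → Matrix (Fin p) (Fin p) ℝ) (hΘ0 : (Θ 0).PosDef)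
    (hΘ0lb : (Θ 0 - α • 1).PosSemidef)
    (ζ : ℕ → ℝ) (hζ : ∀ t, 0 < ζ t ∧ ζ t ≤ α ^ 2)
    (hiter : ∀ t, Θ (t + 1) = softThresh (ζ t * ρ) (Θ t - ζ t • (S - (Θ t)⁻¹))) :
    ∀ t, frobNorm (Θ t - Θs) ≤ frobNorm (Θ 0 - Θs) ∧
      lmax (Θ t) ≤ specNorm Θs + frobNorm (Θ 0 - Θs) := by
  have hα0 : 0 < α := by
    have := specNorm_nonneg S
    rw [hα]
    positivity
  have hα' : α⁻¹ = specNorm S + Fintype.card (Fin p) * ρ := by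
    rw [hα, one_div, inv_inv, Fintype.card_fin]
  have hlb : ∀ t, (Θ t - α • 1).PosSemidef := by
    intro t
    induction t with
    | zero => exact hΘ0lb
    | succ t ih =>
      rw [hiter]
      exact posSemidef_softThresh_step_sub hS hρ.le hα0 hα' (hζ t).1.le (hζ t).2 ih
  have hstep : ∀ t, frobNorm (Θ (t + 1) - Θs) ≤ frobNorm (Θ t - Θs) := by
    intro t
    obtain ⟨hζ0, hζ1⟩ := hζ t
    calc frobNorm (Θ (t + 1) - Θs)
        = frobNorm (softThresh (ζ t * ρ) (Θ t - ζ t • (S - (Θ t)⁻¹)) -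
            softThresh (ζ t * ρ) (Θs - ζ t • (S - Θs⁻¹))) := by
          rw [← hiter, ← hfix (ζ t) hζ0 hζ1]
      _ ≤ frobNorm (Θ t - ζ t • (S - (Θ t)⁻¹) - (Θs - ζ t • (S - Θs⁻¹))) :=
          frobNorm_softThresh_sub_le (mul_nonneg hζ0.le hρ.le) _ _
      _ = frobNorm (Θ t - Θs + ζ t • ((Θ t)⁻¹ - Θs⁻¹)) := by
          congr 1
          simp only [smul_sub]
          abel
      _ ≤ frobNorm (Θ t - Θs) :=
          frobNorm_sub_add_smul_inv_sub_inv_le hα0 hζ0.le hζ1 (hlb t) hΘslb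
  intro t
  have hmono : frobNorm (Θ t - Θs) ≤ frobNorm (Θ 0 - Θs) :=
    antitone_nat_of_succ_le (f := fun t => frobNorm (Θ t - Θs)) hstep (Nat.zero_le t)
  exact ⟨hmono, (lmax_le_specNorm_add_frobNorm _ _).trans (by gcongr)⟩
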